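/- Let Ω be an open bounded Lipschitz subset of ℝ^N, K ∈ ℕ, and let f̃ : Ω × B_K(0) → ℝ satisfy Hypothesis 1. Then for every u ∈ W^{1,∞}(Ω) with ‖∇u‖_∞ < K there exists a sequence v_n ∈ u + W_0^{1,∞}(Ω) such that ‖∇v_n‖_∞ < K for all n, ‖v_n − u‖_∞ → 0, and ∫_Ω f̃(x,∇v_n(x)) dx → ∫_Ω f̃**(x,∇u(x)) dx as n → ∞. -/

import Mathlib

open MeasureTheory Filter Metric Set Topology
open scoped RealInnerProductSpace ENNReal NNReal

/-- Euclidean space `ℝ^N`. -/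
abbrev Euc (N : ℕ) := EuclideanSpace ℝ (Fin N)

/-- A bounded open set with Lipschitz boundary (interior direction condition at the
boundary, a standard property of bounded Lipschitz domains). -/
def IsLipschitzDomain {N : ℕ} (Ω : Set (Euc N)) : Prop :=
  IsOpen Ω ∧ Bornology.IsBounded Ω ∧
    ∀ x ∈ frontier Ω, ∃ v : Euc N, ‖v‖ = 1 ∧ ∃ r > (0 : ℝ), ∃ ε > (0 : ℝ),
      ∀ y ∈ ball x r ∩ closure Ω, ∀ t ∈ Set.Ioo (0 : ℝ) ε, y + t • v ∈ Ω

/-- `u ∈ W^{1,∞}(Ω)`: `u` is (a representative of) a Lipschitz function on `Ω`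
(equivalently, on its closure). -/
def MemW1inf {N : ℕ} (Ω : Set (Euc N)) (u : Euc N → ℝ) : Prop :=
  ∃ C : ℝ≥0, LipschitzOnWith C u (closure Ω)

/-- `‖∇u‖_{L^∞(Ω)} < K`: the essential supremum of `‖∇u‖` on `Ω` is `< K`. -/
def GradSupLt {N : ℕ} (Ω : Set (Euc N)) (u : Euc N → ℝ) (K : ℝ) : Prop :=
  ∃ C : ℝ, C < K ∧ ∀ᵐ x ∂(volume.restrict Ω), ‖gradient u x‖ ≤ C

/-- Weak* convergence `v_n ⇀* u` in `W^{1,∞}(Ω)`: uniform convergence of the functions on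
`Ω` together with weak* convergence of the gradients in `L^∞(Ω; ℝ^N)` (testing against
arbitrary `L¹` vector fields). -/
def WeakStarConvW1inf {N : ℕ} (Ω : Set (Euc N)) (v : ℕ → Euc N → ℝ) (u : Euc N → ℝ) : Prop :=
  TendstoUniformlyOn v u atTop Ω ∧
    ∀ G : Euc N → Euc N, Integrable G (volume.restrict Ω) →
      Tendsto (fun n => ∫ x in Ω, ⟪gradient (v n) x, G x⟫) atTop
        (𝓝 (∫ x in Ω, ⟪gradient u x, G x⟫))

/-- The bipolar `g**` of a function `g` (restricted to the set `s`, i.e. `g = +∞` off `s`)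
with respect to the variable `ξ`: the pointwise supremum of all affine minorants of `g` on
`s`, which is the largest convex lower semicontinuous function below `g` on `s`. -/
noncomputable def convexifyOn {N : ℕ} (g : Euc N → ℝ) (s : Set (Euc N)) (ξ : Euc N) : ℝ :=
  sSup { r : ℝ | ∃ p : Euc N, ∃ c : ℝ, (∀ ζ ∈ s, ⟪p, ζ⟫ + c ≤ g ζ) ∧ r = ⟪p, ξ⟫ + c }

/-- Hypothesis 1 for `f̃ : Ω × B_K(0) → ℝ`:
(a) `f̃` coincides a.e. with a Borel function;
(b) `0 ≤ f̃(x,ξ) ≤ a(x)` for some `a ∈ L¹(Ω)`;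
(c) for every `δ > 0` there is a compact `T ⊆ Ω` with `|Ω \ T| < δ` on which `f̃`
is continuous in `x` uniformly as `ξ` varies in `B_K(0)`. -/
def Hyp1 {N : ℕ} (Ω : Set (Euc N)) (K : ℝ) (f : Euc N → Euc N → ℝ) : Prop :=
  (∃ g : Euc N → Euc N → ℝ, Measurable (Function.uncurry g) ∧
      ∀ᵐ x ∂(volume.restrict Ω), ∀ ξ ∈ ball (0 : Euc N) K, f x ξ = g x ξ) ∧
  (∃ a : Euc N → ℝ, Integrable a (volume.restrict Ω) ∧
      ∀ x ∈ Ω, ∀ ξ ∈ ball (0 : Euc N) K, 0 ≤ f x ξ ∧ f x ξ ≤ a x) ∧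
  (∀ δ > (0 : ℝ), ∃ T : Set (Euc N), T ⊆ Ω ∧ IsCompact T ∧
      volume (Ω \ T) < ENNReal.ofReal δ ∧
      ∀ x ∈ T, ∀ ε > (0 : ℝ), ∃ η > (0 : ℝ), ∀ y ∈ T, dist y x < η →
        ∀ ξ ∈ ball (0 : Euc N) K, |f y ξ - f x ξ| < ε)

section Convexify

variable {N : ℕ} {g : Euc N → ℝ}

theorem le_convexifyOn {s : Set (Euc N)} {ξ p : Euc N} {c : ℝ} (hξ : ξ ∈ s)
    (h : ∀ ζ ∈ s, ⟪p, ζ⟫ + c ≤ g ζ) : ⟪p, ξ⟫ + c ≤ convexifyOn g s ξ := by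
  refine le_csSup ⟨g ξ, ?_⟩ ⟨p, c, h, rfl⟩
  rintro _ ⟨q, d, hq, rfl⟩
  exact hq ξ hξ

theorem affine_minorant_values_nonempty {s : Set (Euc N)} (ξ : Euc N) (h0 : ∀ ζ ∈ s, 0 ≤ g ζ) :
    { r : ℝ | ∃ p : Euc N, ∃ c : ℝ, (∀ ζ ∈ s, ⟪p, ζ⟫ + c ≤ g ζ) ∧ r = ⟪p, ξ⟫ + c }.Nonempty :=
  ⟨0, 0, 0, by simpa using h0, by simp⟩

theorem convexifyOn_nonneg {s : Set (Euc N)} {ξ : Euc N} (hξ : ξ ∈ s)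
    (h0 : ∀ ζ ∈ s, 0 ≤ g ζ) : 0 ≤ convexifyOn g s ξ := by
  have := le_convexifyOn (p := 0) (c := 0) hξ (by simpa using h0)
  simpa using this

theorem convexifyOn_le {s : Set (Euc N)} {ξ : Euc N} (hξ : ξ ∈ s)
    (h0 : ∀ ζ ∈ s, 0 ≤ g ζ) : convexifyOn g s ξ ≤ g ξ := by
  refine csSup_le (affine_minorant_values_nonempty ξ h0) ?_
  rintro _ ⟨q, d, hq, rfl⟩
  exact hq ξ hξ

/-- The slope of an affine function bounded above on a ball is controlled by its value inside. -/
theorem norm_mul_le_of_affine_le {K A c s : ℝ} {ξ p : Euc N} (hs : 0 ≤ s) (hsK : ‖ξ‖ + s < K)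
    (h : ∀ ζ ∈ ball (0 : Euc N) K, c + ⟪p, ζ - ξ⟫ ≤ A) : ‖p‖ * s ≤ A - c := by
  rcases eq_or_ne p 0 with rfl | hp
  · have := h ξ (by simp; linarith)
    simp at this ⊢
    exact this
  have hp' : 0 < ‖p‖ := norm_pos_iff.2 hp
  have := h (ξ + (s / ‖p‖) • p) (by
    rw [mem_ball_zero_iff]
    refine (norm_add_le _ _).trans_lt ?_
    rw [norm_smul, Real.norm_of_nonneg (by positivity), div_mul_cancel₀ _ hp'.ne']
    exact hsK)
  rw [add_sub_cancel_left, inner_smul_right, real_inner_self_eq_norm_sq] at this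
  have e : s / ‖p‖ * ‖p‖ ^ 2 = ‖p‖ * s := by field_simp
  linarith

theorem exists_subgradient {K A : ℝ} {ξ : Euc N} (hξ : ξ ∈ ball (0 : Euc N) K)
    (hg : ∀ ζ ∈ ball (0 : Euc N) K, 0 ≤ g ζ ∧ g ζ ≤ A) :
    ∃ p : Euc N, ∀ ζ ∈ ball (0 : Euc N) K,
      convexifyOn g (ball 0 K) ξ + ⟪p, ζ - ξ⟫ ≤ g ζ := by
  set G := convexifyOn g (ball 0 K) ξ with hG
  have hξ' : ‖ξ‖ < K := by simpa using hξ
  have h0 : 0 ≤ G := convexifyOn_nonneg hξ fun ζ hζ => (hg ζ hζ).1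
  have key : ∀ n : ℕ, ∃ p : Euc N, ∀ ζ ∈ ball (0 : Euc N) K,
      (G - 1 / ((n : ℝ) + 1)) + ⟪p, ζ - ξ⟫ ≤ g ζ := by
    intro n
    have hlt : G - 1 / ((n : ℝ) + 1) < G := by
      have : 0 < 1 / ((n : ℝ) + 1) := by positivity
      linarith
    obtain ⟨_, ⟨p, c, hp, rfl⟩, hr⟩ := exists_lt_of_lt_csSup
      (affine_minorant_values_nonempty ξ fun ζ hζ => (hg ζ hζ).1) hlt
    refine ⟨p, fun ζ hζ => ?_⟩
    have := hp ζ hζ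
    rw [inner_sub_right]
    linarith
  choose p hp using key
  obtain ⟨s, hs, hsK⟩ : ∃ s : ℝ, 0 < s ∧ ‖ξ‖ + s < K := ⟨(K - ‖ξ‖) / 2, by linarith, by linarith⟩
  have hb : ∀ n, p n ∈ closedBall (0 : Euc N) ((A + 1) / s) := by
    intro n
    rw [mem_closedBall_zero_iff, le_div_iff₀ hs]
    have := norm_mul_le_of_affine_le hs.le hsK fun ζ hζ => (hp n ζ hζ).trans (hg ζ hζ).2
    have : 1 / ((n : ℝ) + 1) ≤ 1 := by
      rw [div_le_one (by positivity)]; linarith [(Nat.cast_nonneg n : (0 : ℝ) ≤ n)]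
    linarith
  obtain ⟨q, -, φ, hφ, hq⟩ := tendsto_subseq_of_bounded isBounded_closedBall hb
  refine ⟨q, fun ζ hζ => ?_⟩
  have h1 : Tendsto (fun n => (G - 1 / (((φ n : ℕ) : ℝ) + 1)) + ⟪p (φ n), ζ - ξ⟫) atTop
      (𝓝 ((G - 0) + ⟪q, ζ - ξ⟫)) :=
    ((tendsto_const_nhds.sub
      ((tendsto_one_div_add_atTop_nhds_zero_nat (𝕜 := ℝ)).comp hφ.tendsto_atTop))).add
      (hq.inner tendsto_const_nhds)
  rw [sub_zero] at h1
  exact le_of_tendsto h1 (Eventually.of_forall fun n => hp (φ n) ζ hζ)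

/-- Shrinking the ball slightly barely changes the convexification at an interior point. -/
theorem exists_lt_convexifyOn_ball_le {K A ε : ℝ} {ξ : Euc N} (hε : 0 < ε)
    (hξ : ξ ∈ ball (0 : Euc N) K) (hg : ∀ ζ ∈ ball (0 : Euc N) K, 0 ≤ g ζ ∧ g ζ ≤ A) :
    ∃ K' < K, ξ ∈ ball (0 : Euc N) K' ∧
      convexifyOn g (ball 0 K') ξ ≤ convexifyOn g (ball 0 K) ξ + ε := by
  by_contra! hcon
  set G := convexifyOn g (ball 0 K) ξ with hG
  have hξ' : ‖ξ‖ < K := by simpa using hξ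
  have h0 : 0 ≤ G := convexifyOn_nonneg hξ fun ζ hζ => (hg ζ hζ).1
  set d := K - ‖ξ‖ with hd
  have hd0 : 0 < d := by linarith
  set κ : ℕ → ℝ := fun n => K - d / 2 * (1 / ((n : ℝ) + 1)) with hκ
  have hn1 : ∀ n : ℕ, 0 < 1 / ((n : ℝ) + 1) ∧ 1 / ((n : ℝ) + 1) ≤ 1 := fun n => by
    refine ⟨by positivity, ?_⟩
    rw [div_le_one (by positivity)]; linarith [(Nat.cast_nonneg n : (0 : ℝ) ≤ n)]
  have hκK : ∀ n, κ n < K := fun n => by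
    have := mul_pos (half_pos hd0) (hn1 n).1
    simp only [hκ]; linarith
  have hκd : ∀ n, ‖ξ‖ + d / 2 ≤ κ n := fun n => by
    have := mul_le_mul_of_nonneg_left (hn1 n).2 (half_pos hd0).le
    simp only [hκ]; linarith
  have hξn : ∀ n, ξ ∈ ball (0 : Euc N) (κ n) := fun n => by
    rw [mem_ball_zero_iff]; linarith [hκd n]
  have hsub : ∀ n, ball (0 : Euc N) (κ n) ⊆ ball 0 K := fun n => ball_subset_ball (hκK n).le
  have key : ∀ n, ∃ p : Euc N, ∀ ζ ∈ ball (0 : Euc N) (κ n), (G + ε) + ⟪p, ζ - ξ⟫ ≤ g ζ := by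
    intro n
    obtain ⟨p, hp⟩ := exists_subgradient (hξn n) fun ζ hζ => hg ζ (hsub n hζ)
    exact ⟨p, fun ζ hζ => by linarith [hp ζ hζ, hcon _ (hκK n) (hξn n)]⟩
  choose p hp using key
  have hb : ∀ n, p n ∈ closedBall (0 : Euc N) (A / (d / 4)) := by
    intro n
    rw [mem_closedBall_zero_iff, le_div_iff₀ (by positivity)]
    have := norm_mul_le_of_affine_le (s := d / 4) (by positivity) (by linarith [hκd n])
      fun ζ hζ => (hp n ζ hζ).trans (hg ζ (hsub n hζ)).2
    linarith
  obtain ⟨q, -, φ, hφ, hq⟩ := tendsto_subseq_of_bounded isBounded_closedBall hb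
  have hlim : Tendsto (fun n => κ (φ n)) atTop (𝓝 K) := by
    have : Tendsto κ atTop (𝓝 (K - d / 2 * 0)) :=
      tendsto_const_nhds.sub (tendsto_one_div_add_atTop_nhds_zero_nat.const_mul _)
    rw [mul_zero, sub_zero] at this
    exact this.comp hφ.tendsto_atTop
  have hmin : ∀ ζ ∈ ball (0 : Euc N) K, ⟪q, ζ⟫ + (G + ε - ⟪q, ξ⟫) ≤ g ζ := by
    intro ζ hζ
    have h1 : Tendsto (fun n => (G + ε) + ⟪p (φ n), ζ - ξ⟫) atTop
        (𝓝 ((G + ε) + ⟪q, ζ - ξ⟫)) :=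
      tendsto_const_nhds.add (hq.inner tendsto_const_nhds)
    have h2 : ∀ᶠ n in atTop, (G + ε) + ⟪p (φ n), ζ - ξ⟫ ≤ g ζ := by
      filter_upwards [hlim.eventually (lt_mem_nhds (show ‖ζ‖ < K by simpa using hζ))] with n hn
      exact hp _ _ (by simpa using hn)
    have := le_of_tendsto h1 h2
    rw [inner_sub_right] at this
    linarith
  have := le_convexifyOn hξ hmin
  linarith

theorem mem_closure_convexHull_of_subgradient {K ε : ℝ} {ξ p : Euc N} (hε : 0 < ε)
    (hξ : ξ ∈ ball (0 : Euc N) K)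
    (hp : ∀ ζ ∈ ball (0 : Euc N) K, convexifyOn g (ball 0 K) ξ + ⟪p, ζ - ξ⟫ ≤ g ζ) :
    ξ ∈ closure (convexHull ℝ {ζ | ζ ∈ ball (0 : Euc N) K ∧
      g ζ ≤ convexifyOn g (ball 0 K) ξ + ⟪p, ζ - ξ⟫ + ε}) := by
  by_contra hcon
  set G := convexifyOn g (ball 0 K) ξ with hG
  obtain ⟨l, b, hl, hb⟩ := geometric_hahn_banach_closed_point
    (convex_convexHull ℝ _).closure isClosed_closure hcon
  have hK : 0 ≤ K := by
    have : ‖ξ‖ < K := by simpa using hξ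
    linarith [norm_nonneg ξ]
  set q := (InnerProductSpace.toDual ℝ (Euc N)).symm l with hq
  have hql : ∀ x, l x = ⟪q, x⟫ := fun x => by simp [hq]
  have hden : 0 < ‖q‖ * K + |b| + 1 := by positivity
  set τ := ε / (‖q‖ * K + |b| + 1) with hτ
  have hτ0 : 0 < τ := by positivity
  have hmin : ∀ ζ ∈ ball (0 : Euc N) K, ⟪p + τ • q, ζ⟫ + (G - ⟪p, ξ⟫ - τ * b) ≤ g ζ := by
    intro ζ hζ
    rw [inner_add_left, real_inner_smul_left]
    have h1 := hp ζ hζ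
    rw [inner_sub_right] at h1
    by_cases hA : g ζ ≤ G + ⟪p, ζ - ξ⟫ + ε
    · have h2 := hl ζ (subset_closure (subset_convexHull ℝ _ ⟨hζ, hA⟩))
      rw [hql] at h2
      nlinarith
    · push Not at hA
      rw [inner_sub_right] at hA
      have h3 : ⟪q, ζ⟫ - b ≤ ‖q‖ * K + |b| + 1 := by
        have h4 : ⟪q, ζ⟫ ≤ ‖q‖ * K := (real_inner_le_norm q ζ).trans
          (mul_le_mul_of_nonneg_left (by simpa using (mem_ball_zero_iff.1 hζ).le) (norm_nonneg _))
        linarith [neg_abs_le b]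
      have h5 : τ * (⟪q, ζ⟫ - b) ≤ ε := by
        calc _ ≤ τ * (‖q‖ * K + |b| + 1) := mul_le_mul_of_nonneg_left h3 hτ0.le
          _ = ε := by rw [hτ]; field_simp
      linarith
  have := le_convexifyOn hξ hmin
  rw [inner_add_left, real_inner_smul_left, ← hG] at this
  rw [hql] at hb
  nlinarith

/-- Near an interior point `ξ`, the function `g` is almost affine on a set whose closed convex
hull contains `ξ` and which stays away from the boundary of the ball. -/
theorem exists_almost_affine_set {K A ε : ℝ} {ξ : Euc N} (hε : 0 < ε)
    (hξ : ξ ∈ ball (0 : Euc N) K) (hg : ∀ ζ ∈ ball (0 : Euc N) K, 0 ≤ g ζ ∧ g ζ ≤ A) :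
    ∃ p : Euc N, ∃ K' < K, ∃ S : Set (Euc N), (∀ ζ ∈ S, ‖ζ‖ ≤ K') ∧
      ξ ∈ closure (convexHull ℝ S) ∧
      ∀ ζ ∈ S, |g ζ - convexifyOn g (ball 0 K) ξ - ⟪p, ζ - ξ⟫| ≤ 2 * ε := by
  obtain ⟨K', hK', hξK', hle⟩ := exists_lt_convexifyOn_ball_le hε hξ hg
  have hsub : ball (0 : Euc N) K' ⊆ ball 0 K := ball_subset_ball hK'.le
  obtain ⟨p, hp⟩ := exists_subgradient hξK' fun ζ hζ => hg ζ (hsub hζ)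
  refine ⟨p, K', hK', _, ?_, mem_closure_convexHull_of_subgradient hε hξK' hp, ?_⟩
  · rintro ζ ⟨hζ, -⟩
    exact (mem_ball_zero_iff.1 hζ).le
  · rintro ζ ⟨hζ, h1⟩
    have h2 := hp ζ hζ
    have h3 : convexifyOn g (ball 0 K) ξ ≤ convexifyOn g (ball 0 K') ξ := by
      refine csSup_le (affine_minorant_values_nonempty ξ fun ζ hζ => (hg ζ hζ).1) ?_
      rintro _ ⟨q, d, hq, rfl⟩
      exact le_convexifyOn hξK' fun ζ hζ => hq ζ (hsub hζ)
    rw [abs_le]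
    constructor <;> linarith

end Convexify

section Gradient

variable {N : ℕ}

theorem norm_gradient_eq_norm_fderiv (u : Euc N → ℝ) (x : Euc N) :
    ‖gradient u x‖ = ‖fderiv ℝ u x‖ :=
  LinearIsometryEquiv.norm_map _ _

theorem measurable_gradient (u : Euc N → ℝ) : Measurable (gradient u) :=
  (InnerProductSpace.toDual ℝ (Euc N)).symm.continuous.measurable.comp (measurable_fderiv ℝ u)

theorem LipschitzWith.norm_gradient_le {u : Euc N → ℝ} {C : ℝ≥0} (hu : LipschitzWith C u)
    (x : Euc N) : ‖gradient u x‖ ≤ C := by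
  rw [norm_gradient_eq_norm_fderiv]
  exact norm_fderiv_le_of_lipschitz ℝ hu

theorem integral_inner_gradient_eq_zero {ψ : Euc N → ℝ} {C : ℝ≥0} (hψ : LipschitzWith C ψ)
    (hc : HasCompactSupport ψ) (p : Euc N) : ∫ x, ⟪p, gradient ψ x⟫ = 0 := by
  have h := LipschitzWith.integral_lineDeriv_mul_eq (μ := (volume : Measure (Euc N)))
    (LipschitzWith.const (1 : ℝ)) hψ hc (-p)
  have h1 : ∀ x : Euc N, lineDeriv ℝ (fun _ : Euc N => (1 : ℝ)) x (-p) = 0 := fun x => by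
    simp [lineDeriv]
  simp only [h1, zero_mul, integral_zero, neg_neg, mul_one] at h
  rw [h]
  refine integral_congr_ae ?_
  filter_upwards [hψ.ae_differentiableAt] with x hx
  rw [hx.lineDeriv_eq_fderiv, real_inner_comm, inner_gradient_left]

theorem volume_inner_eq_const {η : Euc N} (hη : η ≠ 0) (c : ℝ) :
    volume {x : Euc N | ⟪η, x⟫ = c} = 0 := by
  rcases eq_empty_or_nonempty {x : Euc N | ⟪η, x⟫ = c} with h | ⟨x₀, hx₀⟩
  · simp [h]
  have hset : {x : Euc N | ⟪η, x⟫ = c} =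
      (AffineSubspace.mk' x₀ (LinearMap.ker (innerSL ℝ η : Euc N →ₗ[ℝ] ℝ)) : Set (Euc N)) := by
    ext x
    have : ⟪η, x₀⟫ = c := hx₀
    simp [AffineSubspace.mem_mk', inner_sub_right, sub_eq_zero, this]
  rw [hset]
  refine Measure.addHaar_affineSubspace _ _ fun htop => hη ?_
  have h1 : x₀ + η ∈ AffineSubspace.mk' x₀ (LinearMap.ker (innerSL ℝ η : Euc N →ₗ[ℝ] ℝ)) := by
    rw [htop]; trivial
  simpa [AffineSubspace.mem_mk'] using h1

/-- A continuous function taking everywhere one of finitely many affine values has almost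
everywhere one of the corresponding slopes as gradient. -/
theorem ae_gradient_mem_of_piecewise_affine {w : Euc N → ℝ} (hw : Continuous w)
    (L : Finset (Euc N × ℝ)) (hL : ∀ x, ∃ l ∈ L, w x = ⟪l.1, x⟫ + l.2) :
    ∀ᵐ x, ∃ l ∈ L, HasGradientAt w l.1 x := by
  have hnull : ∀ᵐ x : Euc N, ∀ l ∈ L, ∀ m ∈ L, ⟪l.1, x⟫ + l.2 = ⟪m.1, x⟫ + m.2 → l.1 = m.1 := by
    rw [Filter.eventually_all_finset]
    intro l _
    rw [Filter.eventually_all_finset]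
    intro m _
    by_cases hlm : l.1 = m.1
    · exact Eventually.of_forall fun _ _ => hlm
    have h0 := volume_inner_eq_const (sub_ne_zero.2 hlm) (m.2 - l.2)
    filter_upwards [measure_eq_zero_iff_ae_notMem.1 h0] with x hx heq
    refine absurd ?_ hx
    simp only [inner_sub_left]
    linarith
  filter_upwards [hnull] with x hx
  obtain ⟨l, hl, hlx⟩ := hL x
  refine ⟨l, hl, ?_⟩
  have hev : ∀ᶠ y in 𝓝 x, ∀ m ∈ L, w y = ⟪m.1, y⟫ + m.2 → w x = ⟪m.1, x⟫ + m.2 := by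
    rw [Filter.eventually_all_finset]
    intro m _
    by_cases hm : w x = ⟪m.1, x⟫ + m.2
    · exact Eventually.of_forall fun _ _ => hm
    have : ContinuousAt (fun y => w y - (⟪m.1, y⟫ + m.2)) x := by fun_prop
    filter_upwards [this.eventually_ne (sub_ne_zero.2 hm)] with y hy h
    exact absurd (sub_eq_zero.2 h) hy
  have heq : w =ᶠ[𝓝 x] fun y => ⟪l.1, y⟫ + l.2 := by
    filter_upwards [hev] with y hy
    obtain ⟨m, hm, hmy⟩ := hL y
    have h1 := hy m hm hmy
    have h2 := hx l hl m hm (by rw [← hlx, h1])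
    rw [hmy, h2]
    rw [hlx, h2] at h1
    linarith
  refine HasGradientAt.congr_of_eventuallyEq ?_ heq
  rw [hasGradientAt_iff_hasFDerivAt]
  exact ((InnerProductSpace.toDual ℝ (Euc N)) l.1).hasFDerivAt.add_const _

/-- If `ξ` lies in the convex hull of `S`, the linear function with slope `ξ` is uniformly
approximated on a ball by Lipschitz functions with almost all gradients in `S`. -/
theorem exists_piecewise_affine_approx {S : Set (Euc N)} {ξ : Euc N}
    (hξ : ξ ∈ convexHull ℝ S) (x₀ : Euc N) {r ρ : ℝ} (hr : 0 < r) (hρ : 0 < ρ) :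
    ∃ w : Euc N → ℝ, (∃ C : ℝ≥0, LipschitzWith C w) ∧ (∀ᵐ x, gradient w x ∈ S) ∧
      ∀ x ∈ closedBall x₀ r, |w x - ⟪ξ, x⟫| ≤ ρ := by
  rw [convexHull_eq_union_convexHull_finite_subsets] at hξ
  obtain ⟨F, hFS, hξF⟩ : ∃ F : Finset (Euc N), (F : Set (Euc N)) ⊆ S ∧
      ξ ∈ convexHull ℝ (F : Set (Euc N)) := by simpa using hξ
  have hFne : F.Nonempty := by
    have := convexHull_nonempty_iff.1 ⟨ξ, hξF⟩
    simpa using this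
  obtain ⟨M, hM⟩ : ∃ M : ℝ≥0, ∀ ζ ∈ F, ‖ζ‖₊ ≤ M := ⟨F.sup fun ζ => ‖ζ‖₊, fun ζ hζ =>
    Finset.le_sup (f := fun ζ => ‖ζ‖₊) hζ⟩
  have hM' : ∀ ζ ∈ F, ‖ζ‖ ≤ M := fun ζ hζ => by exact_mod_cast hM ζ hζ
  have hinner : ∀ ζ ∈ F, ∀ y : Euc N, ⟪ζ, y⟫ ≤ M * ‖y‖ := fun ζ hζ y =>
    (real_inner_le_norm ζ y).trans (mul_le_mul_of_nonneg_right (hM' ζ hζ) (norm_nonneg _))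
  obtain ⟨Z₀, -, hZ₀f, hZ₀⟩ := (isCompact_closedBall x₀ r).finite_cover_balls
    (e := ρ / (M + ‖ξ‖ + 1)) (by positivity)
  obtain ⟨Z, rfl⟩ := hZ₀f.exists_finset_coe
  have hZne : Z.Nonempty := by
    obtain ⟨z, hz, -⟩ := mem_iUnion₂.1 (hZ₀ (mem_closedBall_self hr.le))
    exact ⟨z, hz⟩
  have hpos : ∀ y : Euc N, ∃ ζ ∈ F, ⟪ξ, y⟫ ≤ ⟪ζ, y⟫ := by
    intro y
    by_contra! hcon
    have hconv : Convex ℝ {ζ : Euc N | ⟪ζ, y⟫ < ⟪ξ, y⟫} :=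
      (convex_Iio (⟪ξ, y⟫ : ℝ)).is_linear_preimage
        ⟨fun a b => inner_add_left a b y, fun c a => real_inner_smul_left a y c⟩
    exact lt_irrefl ⟪ξ, y⟫ (mem_ofPred.1 (convexHull_min (fun ζ hζ => hcon ζ hζ) hconv hξF))
  let h : Euc N → Euc N → ℝ := fun z x => F.sup' hFne fun ζ => ⟪ζ, x - z⟫ + ⟪ξ, z⟫
  have hhlip : ∀ z x y, h z x ≤ h z y + M * dist x y := by
    intro z x y
    refine Finset.sup'_le _ _ fun ζ hζ => ?_
    have h1 : ⟪ζ, y - z⟫ + ⟪ξ, z⟫ ≤ h z y :=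
      Finset.le_sup' (fun ζ : Euc N => ⟪ζ, y - z⟫ + ⟪ξ, z⟫) hζ
    have h2 := hinner ζ hζ (x - y)
    rw [dist_eq_norm]
    rw [inner_sub_right] at h1 h2 ⊢
    linarith
  let w : Euc N → ℝ := fun x => Z.inf' hZne fun z => h z x
  have hwlip : LipschitzWith M w := by
    refine LipschitzWith.of_le_add_mul M fun x y => ?_
    obtain ⟨z, hz, hzy⟩ := Finset.exists_mem_eq_inf' hZne fun z => h z y
    have h1 : w x ≤ h z x := Finset.inf'_le (fun z => h z x) hz
    have h2 : w y = h z y := hzy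
    linarith [hhlip z x y]
  refine ⟨w, ⟨M, hwlip⟩, ?_, ?_⟩
  · let L : Finset (Euc N × ℝ) := (Z ×ˢ F).image fun q => (q.2, ⟪ξ, q.1⟫ - ⟪q.2, q.1⟫)
    have hL : ∀ x, ∃ l ∈ L, w x = ⟪l.1, x⟫ + l.2 := by
      intro x
      obtain ⟨z, hz, hzx⟩ := Finset.exists_mem_eq_inf' hZne fun z => h z x
      obtain ⟨ζ, hζ, hζx⟩ := Finset.exists_mem_eq_sup' hFne fun ζ : Euc N => ⟪ζ, x - z⟫ + ⟪ξ, z⟫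
      refine ⟨(ζ, ⟪ξ, z⟫ - ⟪ζ, z⟫), Finset.mem_image.2 ⟨(z, ζ), by simp [hz, hζ], rfl⟩, ?_⟩
      have h1 : w x = h z x := hzx
      have h2 : h z x = ⟪ζ, x - z⟫ + ⟪ξ, z⟫ := hζx
      rw [h1, h2, inner_sub_right]
      ring
    filter_upwards [ae_gradient_mem_of_piecewise_affine hwlip.continuous L hL] with x hx
    obtain ⟨l, hl, hlx⟩ := hx
    obtain ⟨q, hq, rfl⟩ := Finset.mem_image.1 hl
    rw [hlx.gradient]
    exact hFS (Finset.mem_product.1 hq).2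
  · intro x hx
    have hlow : ⟪ξ, x⟫ ≤ w x := by
      refine Finset.le_inf' _ _ fun z _ => ?_
      obtain ⟨ζ, hζ, hle⟩ := hpos (x - z)
      have h1 : ⟪ζ, x - z⟫ + ⟪ξ, z⟫ ≤ h z x :=
        Finset.le_sup' (fun ζ : Euc N => ⟪ζ, x - z⟫ + ⟪ξ, z⟫) hζ
      rw [inner_sub_right] at hle
      linarith
    obtain ⟨z, hz, hzx⟩ := mem_iUnion₂.1 (hZ₀ hx)
    have hup : w x ≤ ⟪ξ, x⟫ + ρ := by
      refine (Finset.inf'_le (fun z => h z x) hz).trans (Finset.sup'_le _ _ fun ζ hζ => ?_)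
      have h1 := hinner ζ hζ (x - z)
      have h2 := real_inner_le_norm ξ (z - x)
      rw [norm_sub_rev, inner_sub_right] at h2
      have h3 : (M + ‖ξ‖ + 1) * ‖x - z‖ ≤ ρ := by
        rw [mem_ball, dist_eq_norm, lt_div_iff₀ (by positivity)] at hzx
        linarith
      nlinarith [norm_nonneg (x - z)]
    rw [abs_le]
    constructor <;> linarith

end Gradient

section Perturbation

variable {N : ℕ}

/-- Lipschitz cutoff equal to one on `closedBall x₀ ((1 - δ) * r)` and vanishing off
`ball x₀ r`. -/
theorem exists_lipschitz_cutoff (x₀ : Euc N) {r δ : ℝ} (hr : 0 < r) (hδ : 0 < δ) :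
    ∃ φ : Euc N → ℝ, (∃ C : ℝ≥0, (C : ℝ) = 1 / (δ * r) ∧ LipschitzWith C φ) ∧
      (∀ x, 0 ≤ φ x ∧ φ x ≤ 1) ∧ (∀ x ∈ closedBall x₀ ((1 - δ) * r), φ x = 1) ∧
      ∀ x, x ∉ closedBall x₀ r → φ x = 0 := by
  have hδr : 0 < δ * r := mul_pos hδ hr
  refine ⟨fun x => max 0 (min 1 ((r - dist x x₀) / (δ * r))),
    ⟨(1 / (δ * r)).toNNReal, Real.coe_toNNReal _ (by positivity), ?_⟩, fun x => ⟨le_max_left _ _, ?_⟩,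
    fun x hx => ?_, fun x hx => ?_⟩
  · refine (LipschitzWith.const_min ?_ 1).const_max 0
    refine LipschitzWith.of_le_add_mul _ fun x y => ?_
    have h := dist_triangle_left y x₀ x
    rw [Real.coe_toNNReal _ (by positivity), one_div_mul_eq_div, ← add_div,
      div_le_div_iff_of_pos_right hδr]
    linarith
  · exact max_le zero_le_one (min_le_left _ _)
  · have h1 : 1 ≤ (r - dist x x₀) / (δ * r) := by
      rw [one_le_div hδr]
      rw [mem_closedBall] at hx
      linarith
    simp [min_eq_left h1]
  · have h1 : (r - dist x x₀) / (δ * r) ≤ 0 := by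
      refine div_nonpos_of_nonpos_of_nonneg ?_ hδr.le
      rw [mem_closedBall, not_le] at hx
      linarith
    exact max_eq_left ((min_le_right _ _).trans h1)

/-- The product of a Lipschitz cutoff supported in `s` and a Lipschitz function bounded on `s`
is Lipschitz. -/
theorem lipschitzWith_cutoff_mul {φ m : Euc N → ℝ} {s : Set (Euc N)} {A B : ℝ≥0} {b : ℝ≥0}
    (hφ : LipschitzWith A φ) (hm : LipschitzWith B m) (h01 : ∀ x, 0 ≤ φ x ∧ φ x ≤ 1)
    (hs : ∀ x, x ∉ s → φ x = 0) (hb : ∀ x ∈ s, |m x| ≤ b) :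
    LipschitzWith (B + b * A) fun x => φ x * m x := by
  have key : ∀ x ∈ s, ∀ y, |φ x * m x - φ y * m y| ≤ (B + b * A) * dist x y := by
    intro x hx y
    have h1 : |m x - m y| ≤ B * dist x y := hm.dist_le_mul x y
    have h2 : |φ x - φ y| ≤ A * dist x y := hφ.dist_le_mul x y
    calc |φ x * m x - φ y * m y| = |φ y * (m x - m y) + m x * (φ x - φ y)| := by ring_nf
      _ ≤ |φ y * (m x - m y)| + |m x * (φ x - φ y)| := abs_add_le _ _
      _ = φ y * |m x - m y| + |m x| * |φ x - φ y| := by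
        rw [abs_mul, abs_mul, abs_of_nonneg (h01 y).1]
      _ ≤ 1 * (B * dist x y) + b * (A * dist x y) := by
        gcongr
        · exact (h01 y).2
        · exact hb x hx
      _ = _ := by ring
  refine LipschitzWith.of_dist_le_mul fun x y => ?_
  rw [Real.dist_eq]
  push_cast
  by_cases hx : x ∈ s
  · exact key x hx y
  by_cases hy : y ∈ s
  · rw [abs_sub_comm, dist_comm]
    exact key y hy x
  · rw [hs x hx, hs y hy]
    simp only [zero_mul, sub_zero, abs_zero]
    positivity

/-- Local modification of `u` on small balls around `x₀`, after which most of the gradients lie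
in `S`, provided that `∇u(x₀)` lies in the closed convex hull of `S`. -/
theorem eventually_exists_perturbation {u : Euc N → ℝ} {Cu : ℝ≥0} (hu : LipschitzWith Cu u)
    {Ω : Set (Euc N)} (hΩ : IsOpen Ω) {x₀ : Euc N} (hx₀ : x₀ ∈ Ω)
    (hd : DifferentiableAt ℝ u x₀) {K C₁ : ℝ} (hC₁ : C₁ < K)
    (hgrad : ∀ᵐ x, x ∈ Ω → ‖gradient u x‖ ≤ C₁) {S : Set (Euc N)} (hS : ∀ ζ ∈ S, ‖ζ‖ ≤ C₁)
    (hmem : gradient u x₀ ∈ closure (convexHull ℝ S)) {δ ε : ℝ} (hδ : 0 < δ) (hε : 0 < ε) :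
    ∀ᶠ r in 𝓝[>] (0 : ℝ), closedBall x₀ r ⊆ Ω ∧ ∃ ψ : Euc N → ℝ,
      (∃ C : ℝ≥0, LipschitzWith C ψ) ∧ (∀ x, x ∉ closedBall x₀ r → ψ x = 0) ∧
      (∀ x, |ψ x| ≤ ε) ∧
      (∃ C < K, ∀ᵐ x, x ∈ closedBall x₀ r → ‖gradient (fun y => u y + ψ y) x‖ ≤ C) ∧
      ∀ᵐ x, x ∈ ball x₀ ((1 - δ) * r) → gradient (fun y => u y + ψ y) x ∈ S := by
  set ξ := gradient u x₀ with hξ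
  set σ := (K - C₁) / 2 with hσ
  have hσ0 : 0 < σ := by simp only [hσ]; linarith
  set β := δ * σ with hβ
  have hβ0 : 0 < β := by positivity
  obtain ⟨ξ', hξ'S, hξ'⟩ := Metric.mem_closure_iff.1 hmem (β / 3) (by positivity)
  have hdiff := (hasGradientAt_iff_isLittleO.1 hd.hasGradientAt).def
    (show (0 : ℝ) < β / 3 by positivity)
  obtain ⟨R₁, hR₁, hR₁u⟩ := Metric.eventually_nhds_iff.1 hdiff
  obtain ⟨R₂, hR₂, hR₂Ω⟩ := Metric.isOpen_iff.1 hΩ x₀ hx₀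
  have hRpos : 0 < min (min R₁ R₂) (ε / β) := by positivity
  filter_upwards [Ioo_mem_nhdsGT hRpos] with r hr
  have hr0 : 0 < r := hr.1
  have hrR₁ : r < R₁ := hr.2.trans_le ((min_le_left _ _).trans (min_le_left _ _))
  have hrR₂ : r < R₂ := hr.2.trans_le ((min_le_left _ _).trans (min_le_right _ _))
  have hrε : β * r ≤ ε := by
    have : r < ε / β := hr.2.trans_le (min_le_right _ _)
    rw [lt_div_iff₀ hβ0] at this
    linarith
  have hBΩ : closedBall x₀ r ⊆ Ω := (closedBall_subset_ball hrR₂).trans hR₂Ω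
  refine ⟨hBΩ, ?_⟩
  obtain ⟨w₀, ⟨Cw, hw₀⟩, hw₀S, hw₀a⟩ := exists_piecewise_affine_approx hξ'S x₀ hr0
    (show 0 < β * r / 3 by positivity)
  set k := u x₀ - ⟪ξ', x₀⟫ with hk
  set w : Euc N → ℝ := fun x => w₀ x + k with hw
  have hwL : LipschitzWith Cw w := LipschitzWith.of_dist_le_mul fun x y => by
    simpa [hw] using hw₀.dist_le_mul x y
  have hwgrad : ∀ x, gradient w x = gradient w₀ x := fun x => by
    simp [gradient, hw, fderiv_add_const]
  obtain ⟨φ, ⟨A, hA, hφ⟩, h01, hφ1, hφ0⟩ := exists_lipschitz_cutoff x₀ hr0 hδ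
  have hmB : ∀ x ∈ closedBall x₀ r, |w x - u x| ≤ β * r := by
    intro x hx
    have hxr : ‖x - x₀‖ ≤ r := by simpa [dist_eq_norm] using hx
    have h1 := hw₀a x hx
    have h2 := hR₁u (lt_of_le_of_lt (mem_closedBall.1 hx) hrR₁)
    rw [Real.norm_eq_abs] at h2
    have h2' : |u x - u x₀ - ⟪ξ, x - x₀⟫| ≤ β / 3 * r :=
      h2.trans (mul_le_mul_of_nonneg_left hxr (by positivity))
    have h3 : |⟪ξ' - ξ, x - x₀⟫| ≤ β / 3 * r := by
      refine (abs_real_inner_le_norm _ _).trans ?_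
      rw [dist_comm, dist_eq_norm] at hξ'
      exact mul_le_mul hξ'.le hxr (norm_nonneg _) (by positivity)
    have h4 : w x - u x = (w₀ x - ⟪ξ', x⟫) - (u x - u x₀ - ⟪ξ, x - x₀⟫) + ⟪ξ' - ξ, x - x₀⟫ := by
      simp only [hw, hk, inner_sub_left, inner_sub_right]
      ring
    rw [h4]
    rw [abs_le] at h1 h2' h3 ⊢
    constructor <;> linarith [h1.1, h1.2, h2'.1, h2'.2, h3.1, h3.2]
  have hψ := lipschitzWith_cutoff_mul (b := (β * r).toNNReal) hφ (hwL.sub hu) h01 hφ0 fun x hx => by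
    rw [Real.coe_toNNReal _ (by positivity)]
    exact hmB x hx
  refine ⟨fun x => φ x * (w x - u x), ⟨_, hψ⟩, fun x hx => by simp [hφ0 x hx], fun x => ?_,
    ⟨C₁ + σ, by simp only [hσ]; linarith, ?_⟩, ?_⟩
  · by_cases hx : x ∈ closedBall x₀ r
    · rw [abs_mul, abs_of_nonneg (h01 x).1]
      calc φ x * |w x - u x| ≤ 1 * (β * r) := by
            gcongr
            · exact (h01 x).2
            · exact hmB x hx
        _ ≤ ε := by linarith
    · simpa [hφ0 x hx] using hε.le
  · filter_upwards [hu.ae_differentiableAt, hwL.ae_differentiableAt, hφ.ae_differentiableAt,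
      hgrad, hw₀S] with x hux hwx hφx hg hwS hxB
    have hD := hux.hasFDerivAt.add (hφx.hasFDerivAt.mul (hwx.hasFDerivAt.sub hux.hasFDerivAt))
    rw [norm_gradient_eq_norm_fderiv]
    have hu1 : ‖fderiv ℝ u x‖ ≤ C₁ := by
      rw [← norm_gradient_eq_norm_fderiv]
      exact hg (hBΩ hxB)
    have hw1 : ‖fderiv ℝ w x‖ ≤ C₁ := by
      rw [← norm_gradient_eq_norm_fderiv, hwgrad]
      exact hS _ hwS
    have hφ2 : ‖fderiv ℝ φ x‖ ≤ 1 / (δ * r) := hA ▸ norm_fderiv_le_of_lipschitz ℝ hφ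
    have e : fderiv ℝ (fun y => u y + φ y * (w y - u y)) x =
        (1 - φ x) • fderiv ℝ u x + φ x • fderiv ℝ w x + (w x - u x) • fderiv ℝ φ x := by
      refine (hD.congr_fderiv ?_).fderiv
      simp only [Pi.sub_apply]
      module
    rw [e]
    calc _ ≤ ‖(1 - φ x) • fderiv ℝ u x‖ + ‖φ x • fderiv ℝ w x‖
            + ‖(w x - u x) • fderiv ℝ φ x‖ := norm_add₃_le
      _ = (1 - φ x) * ‖fderiv ℝ u x‖ + φ x * ‖fderiv ℝ w x‖
            + |w x - u x| * ‖fderiv ℝ φ x‖ := by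
          rw [norm_smul, norm_smul, norm_smul, Real.norm_of_nonneg (h01 x).1,
            Real.norm_of_nonneg (sub_nonneg.2 (h01 x).2), Real.norm_eq_abs]
      _ ≤ (1 - φ x) * C₁ + φ x * C₁ + β * r * (1 / (δ * r)) := by
          have := h01 x
          have := hmB x hxB
          gcongr
          · linarith
          · linarith
      _ = C₁ + σ := by
          rw [hβ]; field_simp; ring
  · filter_upwards [hw₀S] with x hx hxB
    have : (fun y => u y + φ y * (w y - u y)) =ᶠ[𝓝 x] w := by
      filter_upwards [isOpen_ball.mem_nhds hxB] with y hy
      rw [hφ1 y (ball_subset_closedBall hy)]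
      ring
    rw [this.gradient_eq, hwgrad]
    exact hx

end Perturbation

section LocalEstimate

variable {N : ℕ}

theorem ae_eventually_setIntegral_norm_sub_le {F : Type*} [NormedAddCommGroup F]
    {h : Euc N → F} (hh : LocallyIntegrable h) :
    ∀ᵐ x, ∀ ε > 0, ∀ᶠ r in 𝓝[>] (0 : ℝ),
      ∫ y in closedBall x r, ‖h y - h x‖ ≤ ε * volume.real (closedBall x r) := by
  filter_upwards [(Besicovitch.vitaliFamily (volume : Measure (Euc N))).ae_tendsto_average_norm_sub
    hh] with x hx ε hε
  filter_upwards [(hx.comp (Besicovitch.tendsto_filterAt volume x)).eventually (gt_mem_nhds hε),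
    self_mem_nhdsWithin] with r hr hr0
  have hV : 0 < volume.real (closedBall x r) :=
    ENNReal.toReal_pos (measure_closedBall_pos volume x hr0).ne' measure_closedBall_lt_top.ne
  simp only [Function.comp, setAverage_eq, smul_eq_mul] at hr
  rw [inv_mul_eq_div, div_lt_iff₀ hV] at hr
  exact hr.le

theorem ae_mem_eventually_volume_diff_le {T : Set (Euc N)} (hT : MeasurableSet T) :
    ∀ᵐ x, x ∈ T → ∀ ε > 0, ∀ᶠ r in 𝓝[>] (0 : ℝ),
      volume.real (closedBall x r \ T) ≤ ε * volume.real (closedBall x r) := by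
  have hloc : LocallyIntegrable (Tᶜ.indicator (1 : Euc N → ℝ)) :=
    (locallyIntegrable_const (1 : ℝ)).indicator hT.compl
  filter_upwards [ae_eventually_setIntegral_norm_sub_le hloc] with x hx hxT ε hε
  filter_upwards [hx ε hε] with r hr
  have h0 : Tᶜ.indicator (1 : Euc N → ℝ) x = 0 := by simp [hxT]
  have h1 : ∀ y, ‖Tᶜ.indicator (1 : Euc N → ℝ) y - Tᶜ.indicator (1 : Euc N → ℝ) x‖ =
      Tᶜ.indicator (1 : Euc N → ℝ) y := fun y => by
    rw [h0, sub_zero]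
    exact Real.norm_of_nonneg (indicator_nonneg (fun _ _ => zero_le_one) y)
  simp only [h1] at hr
  rw [integral_indicator_one hT.compl, measureReal_restrict_apply hT.compl, inter_comm,
    ← sdiff_eq] at hr
  exact hr

theorem exists_volume_annulus_le (N : ℕ) {ε : ℝ} (hε : 0 < ε) :
    ∃ δ > 0, ∀ (x : Euc N) (r : ℝ), 0 < r →
      volume.real (closedBall x r \ ball x ((1 - δ) * r)) ≤ ε * volume.real (closedBall x r) := by
  have hcont : Tendsto (fun δ : ℝ => 1 - (1 - δ) ^ N) (𝓝[>] 0) (𝓝 0) := by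
    have : ContinuousAt (fun δ : ℝ => 1 - (1 - δ) ^ N) 0 := by fun_prop
    have := this.tendsto.mono_left (nhdsWithin_le_nhds (s := Ioi 0))
    simpa using this
  obtain ⟨δ, hδε, hδ0, hδ1⟩ := ((hcont.eventually (gt_mem_nhds hε)).and
    (Ioo_mem_nhdsGT (zero_lt_one' ℝ))).exists
  refine ⟨δ, hδ0, fun x r hr => ?_⟩
  have hr' : 0 < (1 - δ) * r := mul_pos (by linarith) hr
  have hsub : ball x ((1 - δ) * r) ⊆ closedBall x r :=
    ball_subset_closedBall.trans (closedBall_subset_closedBall (by nlinarith))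
  have hball : volume.real (ball x ((1 - δ) * r)) =
      ((1 - δ) * r) ^ N * volume.real (ball (0 : Euc N) 1) := by
    rw [measureReal_def, Measure.addHaar_ball_of_pos _ _ hr', ENNReal.toReal_mul,
      ENNReal.toReal_ofReal (by positivity), measureReal_def, finrank_euclideanSpace_fin]
  rw [measureReal_sdiff hsub measurableSet_ball measure_closedBall_lt_top.ne, hball,
    Measure.addHaar_real_closedBall _ _ hr.le, finrank_euclideanSpace_fin]
  have hc : 0 ≤ r ^ N * volume.real (ball (0 : Euc N) 1) := by positivity
  rw [mul_pow]
  nlinarith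

/-- Around a sufficiently regular point `x₀`, the function `u` can be modified on every small ball
so that the integral of `f(x, ∇v)` over the ball is close to the relaxed one. -/
theorem eventually_exists_good_perturbation {u : Euc N → ℝ} {Cu : ℝ≥0} (hu : LipschitzWith Cu u)
    {Ω T : Set (Euc N)} (hΩ : IsOpen Ω) (hTΩ : T ⊆ Ω) (hT : MeasurableSet T) {K C₀ : ℝ}
    (hC₀ : C₀ < K) (hgrad : ∀ᵐ x, x ∈ Ω → ‖gradient u x‖ ≤ C₀)
    {f : Euc N → Euc N → ℝ} {a H : Euc N → ℝ}
    (hfa : ∀ x ∈ Ω, ∀ ξ ∈ ball (0 : Euc N) K, 0 ≤ f x ξ ∧ f x ξ ≤ a x)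
    (hint : ∀ (G : Euc N → Euc N) (s : Set (Euc N)), Measurable G → MeasurableSet s → s ⊆ Ω →
      (∀ᵐ x, x ∈ s → G x ∈ ball (0 : Euc N) K) → IntegrableOn (fun x => f x (G x)) s)
    (hH : Integrable H) {x₀ : Euc N} (hx₀ : x₀ ∈ T)
    (hcont : ∀ ε > 0, ∃ η > 0, ∀ y ∈ T, dist y x₀ < η →
      ∀ ξ ∈ ball (0 : Euc N) K, |f y ξ - f x₀ ξ| < ε)
    (hd : DifferentiableAt ℝ u x₀) (hg₀ : ‖gradient u x₀‖ ≤ C₀)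
    (hHx : H x₀ = convexifyOn (f x₀) (ball 0 K) (gradient u x₀))
    (hLu : ∀ ε > 0, ∀ᶠ r in 𝓝[>] (0 : ℝ), ∫ y in closedBall x₀ r,
      ‖gradient u y - gradient u x₀‖ ≤ ε * volume.real (closedBall x₀ r))
    (hLH : ∀ ε > 0, ∀ᶠ r in 𝓝[>] (0 : ℝ), ∫ y in closedBall x₀ r,
      ‖H y - H x₀‖ ≤ ε * volume.real (closedBall x₀ r))
    (hdens : ∀ ε > 0, ∀ᶠ r in 𝓝[>] (0 : ℝ),
      volume.real (closedBall x₀ r \ T) ≤ ε * volume.real (closedBall x₀ r))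
    {ε : ℝ} (hε : 0 < ε) :
    ∀ᶠ r in 𝓝[>] (0 : ℝ), closedBall x₀ r ⊆ Ω ∧ ∃ ψ : Euc N → ℝ,
      (∃ C : ℝ≥0, LipschitzWith C ψ) ∧ (∀ x, x ∉ closedBall x₀ r → ψ x = 0) ∧
      (∀ x, |ψ x| ≤ ε) ∧
      (∃ C < K, ∀ᵐ x, x ∈ closedBall x₀ r → ‖gradient (fun y => u y + ψ y) x‖ ≤ C) ∧
      |∫ x in closedBall x₀ r ∩ T, (f x (gradient (fun y => u y + ψ y) x) - H x)| ≤
        ε * volume.real (closedBall x₀ r) := by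
  set ξ := gradient u x₀ with hξ
  have hξK : ξ ∈ ball (0 : Euc N) K := by rw [mem_ball_zero_iff]; linarith
  have hK : 0 < K := by linarith [norm_nonneg ξ]
  set e := min (ε / 8) 1 with he
  have he0 : 0 < e := by positivity
  have he1 : e ≤ 1 := min_le_right _ _
  have heε : 8 * e ≤ ε := by linarith [min_le_left (ε / 8) 1]
  have hfx₀ := hfa x₀ (hTΩ hx₀)
  obtain ⟨p, K', hK', S, hSK', hξS, hS⟩ := exists_almost_affine_set he0 hξK hfx₀
  rw [← hHx] at hS
  have hH0 : 0 ≤ H x₀ := hHx ▸ convexifyOn_nonneg hξK fun ζ hζ => (hfx₀ ζ hζ).1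
  have hHa : H x₀ ≤ a x₀ :=
    hHx ▸ (convexifyOn_le hξK fun ζ hζ => (hfx₀ ζ hζ).1).trans (hfx₀ ξ hξK).2
  set M := 2 * a x₀ + 1 + ‖p‖ * (2 * K) with hM
  have hpK : 0 ≤ ‖p‖ * (2 * K) := by positivity
  have hM0 : 0 < M := by linarith
  obtain ⟨δ, hδ0, hδ⟩ := exists_volume_annulus_le N (div_pos he0 hM0)
  obtain ⟨η, hη0, hη⟩ := hcont e he0
  have hC₁ : max C₀ K' < K := max_lt hC₀ hK'
  have hpert := eventually_exists_perturbation hu hΩ (hTΩ hx₀) hd hC₁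
    (hgrad.mono fun x hx hxΩ => (hx hxΩ).trans (le_max_left _ _))
    (fun ζ hζ => (hSK' ζ hζ).trans (le_max_right _ _)) hξS hδ0 hε
  filter_upwards [hpert, hLu (e / (‖p‖ + 1)) (by positivity), hLH e he0,
    hdens (e / M) (by positivity), Ioo_mem_nhdsGT hη0] with r hr hru hrH hrT hrη
  obtain ⟨hBΩ, ψ, ⟨Cψ, hψ⟩, hψ0, hψε, ⟨C, hCK, hC⟩, hψS⟩ := hr
  refine ⟨hBΩ, ψ, ⟨Cψ, hψ⟩, hψ0, hψε, ⟨C, hCK, hC⟩, ?_⟩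
  set B := closedBall x₀ r with hB
  set V := volume.real B with hV
  have hBm : MeasurableSet B := measurableSet_closedBall
  have hBT : MeasurableSet (B ∩ T) := hBm.inter hT
  have hBfin : volume B < ∞ := measure_closedBall_lt_top
  have hV0 : 0 ≤ V := measureReal_nonneg
  set v : Euc N → ℝ := fun y => u y + ψ y with hv
  have hvball : ∀ᵐ x, x ∈ B → gradient v x ∈ ball (0 : Euc N) K :=
    hC.mono fun x hx hxB => mem_ball_zero_iff.2 ((hx hxB).trans_lt hCK)
  set D : Euc N → ℝ := fun x => ⟪p, gradient v x - ξ⟫ with hD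
  have hDbound : ∀ᵐ x, x ∈ B → ‖D x‖ ≤ ‖p‖ * (2 * K) := by
    filter_upwards [hvball] with x hx hxB
    refine (norm_inner_le_norm _ _).trans (mul_le_mul_of_nonneg_left ?_ (norm_nonneg _))
    refine (norm_sub_le _ _).trans ?_
    have := mem_ball_zero_iff.1 (hx hxB)
    have := mem_ball_zero_iff.1 hξK
    linarith
  have hDm : Measurable D :=
    (innerSL ℝ p).continuous.measurable.comp ((measurable_gradient v).sub_const ξ)
  have hDint : IntegrableOn D B := Measure.integrableOn_of_bounded hBfin.ne
    hDm.aestronglyMeasurable ((ae_restrict_iff' hBm).2 hDbound)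
  have hfint : IntegrableOn (fun x => f x (gradient v x)) (B ∩ T) :=
    hint _ _ (measurable_gradient v) hBT (inter_subset_left.trans hBΩ)
      (hvball.mono fun x hx hxBT => hx hxBT.1)
  have hDint' : IntegrableOn D (B ∩ T) := hDint.mono_set inter_subset_left
  have hconst : ∀ c : ℝ, IntegrableOn (fun _ : Euc N => c) B := fun c =>
    integrableOn_const hBfin.ne
  have hconst' : ∀ c : ℝ, IntegrableOn (fun _ : Euc N => c) (B ∩ T) := fun c =>
    (hconst c).mono_set inter_subset_left
  have hI₁ : |∫ x in B ∩ T, (f x (gradient v x) - H x₀ - D x)| ≤ 4 * e * V := by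
    set b : Euc N → ℝ := fun x => 3 * e + (ball x₀ ((1 - δ) * r))ᶜ.indicator (fun _ => M) x with hb
    have hbint : IntegrableOn b (B ∩ T) :=
      (hconst' _).add ((hconst' M).indicator measurableSet_ball.compl)
    have hle : ∀ᵐ x ∂volume.restrict (B ∩ T), ‖f x (gradient v x) - H x₀ - D x‖ ≤ b x := by
      rw [ae_restrict_iff' hBT]
      filter_upwards [hvball, hψS, hDbound] with x hvx hSx hDx hx
      have hxη : dist x x₀ < η := (mem_closedBall.1 hx.1).trans_lt hrη.2
      have h1 := hη x hx.2 hxη _ (hvx hx.1)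
      rw [Real.norm_eq_abs]
      by_cases hxb : x ∈ ball x₀ ((1 - δ) * r)
      · have h2 := hS _ (hSx hxb)
        have : b x = 3 * e := by simp [hb, hxb]
        rw [this]
        rw [abs_lt] at h1
        rw [abs_le] at h2 ⊢
        constructor <;> linarith [h1.1, h1.2, h2.1, h2.2]
      · have h2 := hDx hx.1
        have h3 := hfx₀ _ (hvx hx.1)
        have : b x = 3 * e + M := by simp [hb, hxb]
        rw [this]
        rw [abs_lt] at h1
        rw [Real.norm_eq_abs, abs_le] at h2
        rw [abs_le]
        constructor <;> linarith [h1.1, h1.2, h2.1, h2.2, h3.1, h3.2]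
    have h4 := norm_integral_le_of_norm_le hbint hle
    rw [Real.norm_eq_abs] at h4
    have h5 : ∫ x in B ∩ T, b x = 3 * e * volume.real (B ∩ T) +
        M * volume.real ((ball x₀ ((1 - δ) * r))ᶜ ∩ (B ∩ T)) := by
      rw [hb, integral_add (hconst' _) ((hconst' M).indicator measurableSet_ball.compl),
        setIntegral_const, integral_indicator measurableSet_ball.compl,
        Measure.restrict_restrict measurableSet_ball.compl, setIntegral_const, smul_eq_mul,
        smul_eq_mul]
      ring
    have h6 : volume.real (B ∩ T) ≤ V := measureReal_mono inter_subset_left hBfin.ne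
    have h7 : volume.real ((ball x₀ ((1 - δ) * r))ᶜ ∩ (B ∩ T)) ≤ e / M * V := by
      refine le_trans (measureReal_mono ?_ (measure_mono sdiff_subset |>.trans_lt hBfin).ne)
        (hδ x₀ r hrη.1)
      rintro x ⟨h1, h2, -⟩
      exact ⟨h2, h1⟩
    have h8 : M * (e / M * V) = e * V := by field_simp
    have h9 := mul_le_mul_of_nonneg_left h7 hM0.le
    have h10 := mul_le_mul_of_nonneg_left h6 (show 0 ≤ 3 * e by positivity)
    linarith
  have hI₂ : |∫ x in B ∩ T, D x| ≤ 2 * e * V := by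
    have h1 := integral_inter_add_sdiff hT hDint
    have h2 : ‖∫ x in B \ T, D x‖ ≤ ‖p‖ * (2 * K) * volume.real (B \ T) :=
      norm_setIntegral_le_of_norm_le_const_ae' ((measure_mono sdiff_subset).trans_lt hBfin)
        (hDbound.mono fun x hx hxB => hx hxB.1)
    have h3 : ‖p‖ * (2 * K) * volume.real (B \ T) ≤ e * V := by
      calc _ ≤ M * (e / M * V) :=
            mul_le_mul (by linarith) hrT measureReal_nonneg hM0.le
        _ = e * V := by field_simp
    have hψc : HasCompactSupport ψ := HasCompactSupport.intro (isCompact_closedBall x₀ r) hψ0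
    have hψint : ∫ x in B, ⟪p, gradient ψ x⟫ = 0 := by
      rw [setIntegral_eq_integral_of_forall_compl_eq_zero, integral_inner_gradient_eq_zero hψ hψc]
      intro x hx
      have : ψ =ᶠ[𝓝 x] fun _ => 0 := by
        filter_upwards [isClosed_closedBall.isOpen_compl.mem_nhds hx] with y hy
        exact hψ0 y hy
      rw [this.gradient_eq, gradient_fun_const, inner_zero_right]
    have hgu : IntegrableOn (fun x => gradient u x - ξ) B :=
      Measure.integrableOn_of_bounded hBfin.ne
        ((measurable_gradient u).sub_const ξ).aestronglyMeasurable (M := Cu + ‖ξ‖)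
        (Eventually.of_forall fun x => (norm_sub_le _ _).trans
          (add_le_add_left (hu.norm_gradient_le x) _))
    have hgψ : IntegrableOn (gradient ψ) B :=
      Measure.integrableOn_of_bounded hBfin.ne (measurable_gradient ψ).aestronglyMeasurable
        (Eventually.of_forall fun x => hψ.norm_gradient_le x)
    have hDeq : ∫ x in B, D x = ∫ x in B, ⟪p, gradient u x - ξ⟫ := by
      have : ∫ x in B, D x = ∫ x in B, (⟪p, gradient u x - ξ⟫ + ⟪p, gradient ψ x⟫) := by
        refine integral_congr_ae (ae_restrict_of_ae ?_)
        filter_upwards [hu.ae_differentiableAt, hψ.ae_differentiableAt] with x hux hψx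
        have hs : gradient v x = gradient u x + gradient ψ x := by
          simp only [gradient, hv]
          rw [fderiv_fun_add hux hψx, map_add]
        simp only [hD, hs, ← inner_add_right]
        congr 1
        abel
      rw [this, integral_add (hgu.const_inner p) (hgψ.const_inner p), hψint, add_zero]
    have h4 : ‖∫ x in B, D x‖ ≤ e * V := by
      rw [hDeq]
      calc ‖∫ x in B, ⟪p, gradient u x - ξ⟫‖ ≤ ∫ x in B, ‖p‖ * ‖gradient u x - ξ‖ :=
            norm_integral_le_of_norm_le (hgu.norm.const_mul _)
              (Eventually.of_forall fun x => norm_inner_le_norm _ _)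
        _ = ‖p‖ * ∫ x in B, ‖gradient u x - ξ‖ := integral_const_mul _ _
        _ ≤ (‖p‖ + 1) * (e / (‖p‖ + 1) * V) :=
            mul_le_mul (by linarith) hru (integral_nonneg fun _ => norm_nonneg _) (by positivity)
        _ = e * V := by field_simp
    rw [Real.norm_eq_abs, abs_le] at h2 h4
    rw [abs_le]
    constructor <;> linarith [h2.1, h2.2, h4.1, h4.2]
  have hHint : IntegrableOn (fun x => H x - H x₀) B := hH.integrableOn.sub (hconst _)
  have hHint' : IntegrableOn (fun x => H x - H x₀) (B ∩ T) := hHint.mono_set inter_subset_left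
  have hI₃ : |∫ x in B ∩ T, (H x - H x₀)| ≤ e * V := by
    rw [← Real.norm_eq_abs]
    refine (norm_integral_le_integral_norm (fun x => H x - H x₀)).trans (le_trans ?_ hrH)
    exact setIntegral_mono_set hHint.norm (Eventually.of_forall fun _ => norm_nonneg _)
      inter_subset_left.eventuallyLE
  have hsplit : ∫ x in B ∩ T, (f x (gradient v x) - H x) =
      (∫ x in B ∩ T, (f x (gradient v x) - H x₀ - D x)) + (∫ x in B ∩ T, D x) -
        ∫ x in B ∩ T, (H x - H x₀) := by
    have hX : IntegrableOn (fun x => f x (gradient v x) - H x₀ - D x) (B ∩ T) :=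
      (hfint.sub (hconst' _)).sub hDint'
    have hY : IntegrableOn (fun x => f x (gradient v x) - H x₀ - D x + D x) (B ∩ T) :=
      hX.add hDint'
    rw [← integral_add hX hDint', ← integral_sub hY hHint']
    congr 1
    ext x
    ring
  rw [hsplit]
  have : 8 * e * V ≤ ε * V := mul_le_mul_of_nonneg_right heε hV0
  have heV : 0 ≤ e * V := by positivity
  rw [abs_le] at hI₁ hI₂ hI₃ ⊢
  constructor <;> linarith [hI₁.1, hI₁.2, hI₂.1, hI₂.2, hI₃.1, hI₃.2]

end LocalEstimate

section Integrability

variable {N : ℕ}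

theorem convexOn_convexifyOn {g : Euc N → ℝ} {s : Set (Euc N)} (hs : Convex ℝ s)
    (h0 : ∀ ζ ∈ s, 0 ≤ g ζ) : ConvexOn ℝ s (convexifyOn g s) := by
  refine ⟨hs, fun ξ hξ ζ hζ a b ha hb hab => ?_⟩
  refine csSup_le (affine_minorant_values_nonempty _ h0) ?_
  rintro _ ⟨p, c, hpc, rfl⟩
  have h1 := le_convexifyOn hξ hpc
  have h2 := le_convexifyOn hζ hpc
  rw [inner_add_right, real_inner_smul_right, real_inner_smul_right, smul_eq_mul, smul_eq_mul]
  have hc : c = a * c + b * c := by rw [← add_mul, hab, one_mul]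
  nlinarith [mul_le_mul_of_nonneg_left h1 ha, mul_le_mul_of_nonneg_left h2 hb]

theorem convexifyOn_le_add {g h : Euc N → ℝ} {s : Set (Euc N)} {ξ : Euc N} (hξ : ξ ∈ s)
    (h0 : ∀ ζ ∈ s, 0 ≤ g ζ) {ε : ℝ} (hgh : ∀ ζ ∈ s, g ζ ≤ h ζ + ε) :
    convexifyOn g s ξ ≤ convexifyOn h s ξ + ε := by
  refine csSup_le (affine_minorant_values_nonempty _ h0) ?_
  rintro _ ⟨p, c, hpc, rfl⟩
  have := le_convexifyOn (g := h) (p := p) (c := c - ε) hξ fun ζ hζ => by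
    linarith [hpc ζ hζ, hgh ζ hζ]
  linarith

/-- If `f` is continuous in `x ∈ T` uniformly in `ξ`, then its bipolar is jointly continuous. -/
theorem continuousOn_convexifyOn {f : Euc N → Euc N → ℝ} {T : Set (Euc N)} {K : ℝ}
    (h0 : ∀ x ∈ T, ∀ ζ ∈ ball (0 : Euc N) K, 0 ≤ f x ζ)
    (hcont : ∀ x ∈ T, ∀ ε > (0 : ℝ), ∃ η > (0 : ℝ), ∀ y ∈ T, dist y x < η →
        ∀ ξ ∈ ball (0 : Euc N) K, |f y ξ - f x ξ| < ε) :
    ContinuousOn (fun z : Euc N × Euc N => convexifyOn (f z.1) (ball 0 K) z.2)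
      (T ×ˢ ball (0 : Euc N) K) := by
  rintro ⟨x, ξ⟩ ⟨hx, hξ⟩
  have hc : ContinuousOn (convexifyOn (f x) (ball 0 K)) (ball 0 K) :=
    (convexOn_convexifyOn (convex_ball 0 K) (h0 x hx)).continuousOn isOpen_ball
  rw [ContinuousWithinAt, Metric.tendsto_nhds]
  intro ε hε
  obtain ⟨η, hη, hfη⟩ := hcont x hx (ε / 2) (half_pos hε)
  have h1 : ∀ᶠ z : Euc N × Euc N in 𝓝[T ×ˢ ball (0 : Euc N) K] (x, ξ), dist z.1 x < η :=
    mem_nhdsWithin_of_mem_nhds (continuous_fst.tendsto (x, ξ) (ball_mem_nhds x hη))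
  have h2 : ∀ᶠ z : Euc N × Euc N in 𝓝[T ×ˢ ball (0 : Euc N) K] (x, ξ),
      dist (convexifyOn (f x) (ball 0 K) z.2) (convexifyOn (f x) (ball 0 K) ξ) < ε / 2 :=
    mem_nhdsWithin_of_mem_nhds (continuous_snd.continuousAt.eventually
      ((hc.continuousAt (isOpen_ball.mem_nhds hξ)).eventually (ball_mem_nhds _ (half_pos hε))))
  filter_upwards [h1, h2, self_mem_nhdsWithin] with z hz1 hz2 hz
  have h3 := convexifyOn_le_add (g := f z.1) (h := f x) hz.2 (h0 _ hz.1) (ε := ε / 2) fun ζ hζ => by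
    linarith [(abs_lt.1 (hfη z.1 hz.1 hz1 ζ hζ)).2]
  have h4 := convexifyOn_le_add (g := f x) (h := f z.1) hz.2 (h0 _ hx) (ε := ε / 2) fun ζ hζ => by
    linarith [(abs_lt.1 (hfη z.1 hz.1 hz1 ζ hζ)).1]
  rw [Real.dist_eq, abs_lt] at hz2 ⊢
  constructor <;> linarith [hz2.1, hz2.2]

theorem Hyp1.aemeasurable_convexifyOn {Ω : Set (Euc N)} {K : ℝ} {f : Euc N → Euc N → ℝ}
    (hf : Hyp1 Ω K f) {G : Euc N → Euc N} (hG : Measurable G)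
    (hGK : ∀ᵐ x ∂volume.restrict Ω, G x ∈ ball (0 : Euc N) K) :
    AEMeasurable (fun x => convexifyOn (f x) (ball (0 : Euc N) K) (G x))
      (volume.restrict Ω) := by
  classical
  obtain ⟨-, ⟨a, -, hfa⟩, hc⟩ := hf
  choose T hTΩ hTc hTδ hT using fun n : ℕ => hc (1 / (n + 1)) Nat.one_div_pos_of_nat
  have hTn : ∀ n, AEMeasurable (fun x => convexifyOn (f x) (ball (0 : Euc N) K) (G x))
      (volume.restrict (T n)) := by
    intro n
    have hm : MeasurableSet (T n ×ˢ ball (0 : Euc N) K) :=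
      (hTc n).measurableSet.prod measurableSet_ball
    have hind := (continuousOn_convexifyOn
      (fun x hx ζ hζ => (hfa x (hTΩ n hx) ζ hζ).1) (hT n)).measurable_piecewise
      (g := fun _ => 0) continuousOn_const hm
    refine ⟨_, hind.comp (measurable_id.prodMk hG), ?_⟩
    filter_upwards [ae_restrict_mem (hTc n).measurableSet,
      ae_restrict_of_ae_restrict_of_subset (hTΩ n) hGK] with x hx hGx
    have hmem : (x, G x) ∈ T n ×ˢ ball (0 : Euc N) K := ⟨hx, hGx⟩
    simp only [Function.comp, id, piecewise_eq_of_mem _ _ _ hmem]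
  have hnull : volume (Ω \ ⋃ n, T n) = 0 := by
    refine le_antisymm (ge_of_tendsto' (f := fun n : ℕ => ENNReal.ofReal (1 / (n + 1)))
      (x := atTop) ?_ fun n => (measure_mono
        (sdiff_subset_sdiff_right (subset_iUnion T n))).trans (hTδ n).le) bot_le
    simpa using ENNReal.tendsto_ofReal tendsto_one_div_add_atTop_nhds_zero_nat
  refine (aemeasurable_iUnion_iff.2 hTn).mono_ac (Measure.restrict_mono_ae ?_).absolutelyContinuous
  exact ae_le_set.2 hnull

theorem Hyp1.integrableOn_comp {Ω : Set (Euc N)} {K : ℝ} {f : Euc N → Euc N → ℝ}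
    (hf : Hyp1 Ω K f) {G : Euc N → Euc N} (hG : Measurable G) {s : Set (Euc N)}
    (hs : MeasurableSet s) (hsΩ : s ⊆ Ω) (hGK : ∀ᵐ x, x ∈ s → G x ∈ ball (0 : Euc N) K) :
    IntegrableOn (fun x => f x (G x)) s := by
  obtain ⟨⟨g, hg, hfg⟩, ⟨a, ha, hfa⟩, -⟩ := hf
  have hGs := (ae_restrict_iff' hs).2 hGK
  refine Integrable.mono' (IntegrableOn.mono_set ha hsΩ) ⟨fun x => g x (G x),
    (hg.comp (measurable_id.prodMk hG)).stronglyMeasurable, ?_⟩ ?_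
  · filter_upwards [ae_restrict_of_ae_restrict_of_subset hsΩ hfg, hGs] with x hx hGx
    exact hx _ hGx
  · filter_upwards [ae_restrict_mem hs, hGs] with x hx hGx
    have := hfa x (hsΩ hx) _ hGx
    rw [Real.norm_of_nonneg this.1]
    exact this.2

theorem Hyp1.integrableOn_convexifyOn {Ω : Set (Euc N)} {K : ℝ} {f : Euc N → Euc N → ℝ}
    (hΩ : MeasurableSet Ω) (hf : Hyp1 Ω K f) {G : Euc N → Euc N} (hG : Measurable G)
    (hGK : ∀ᵐ x ∂volume.restrict Ω, G x ∈ ball (0 : Euc N) K) :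
    IntegrableOn (fun x => convexifyOn (f x) (ball (0 : Euc N) K) (G x)) Ω := by
  have hm := (hf.aemeasurable_convexifyOn hG hGK).aestronglyMeasurable
  obtain ⟨-, ⟨a, ha, hfa⟩, -⟩ := hf
  refine Integrable.mono' ha hm ?_
  filter_upwards [ae_restrict_mem hΩ, hGK] with x hx hGx
  have h0 : ∀ ζ ∈ ball (0 : Euc N) K, 0 ≤ f x ζ := fun ζ hζ => (hfa x hx ζ hζ).1
  rw [Real.norm_of_nonneg (convexifyOn_nonneg hGx h0)]
  exact (convexifyOn_le hGx h0).trans (hfa x hx _ hGx).2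

end Integrability

section Gluing

variable {N : ℕ} {ι : Type*} {F : Finset ι} {B : ι → Set (Euc N)} {ψ : ι → Euc N → ℝ}

theorem sum_eq_of_notMem_support (hψ : ∀ i, ∀ x ∉ B i, ψ i x = 0) {i : ι} (hi : i ∈ F)
    {x : Euc N} (hx : ∀ j ∈ F, j ≠ i → x ∉ B j) : ∑ j ∈ F, ψ j x = ψ i x :=
  Finset.sum_eq_single_of_mem i hi fun j hj hji => hψ j x (hx j hj hji)

theorem abs_sum_le_of_disjoint_support (hψ : ∀ i, ∀ x ∉ B i, ψ i x = 0)
    (hd : Pairwise (Function.onFun Disjoint B)) {ε : ℝ} (hε : 0 ≤ ε) (hψε : ∀ i x, |ψ i x| ≤ ε)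
    (x : Euc N) : |∑ i ∈ F, ψ i x| ≤ ε := by
  by_cases h : ∃ i ∈ F, x ∈ B i
  · obtain ⟨i, hi, hx⟩ := h
    rw [sum_eq_of_notMem_support hψ hi fun j _ hji hxj => (hd hji).ne_of_mem hxj hx rfl]
    exact hψε i x
  · push Not at h
    rw [Finset.sum_eq_zero fun i hi => hψ i x (h i hi), abs_zero]
    exact hε

theorem gradient_add_sum_of_mem (hB : ∀ i, IsClosed (B i)) (hψ : ∀ i, ∀ x ∉ B i, ψ i x = 0)
    (hd : Pairwise (Function.onFun Disjoint B)) (u : Euc N → ℝ) {i : ι} (hi : i ∈ F) {x : Euc N}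
    (hx : x ∈ B i) :
    gradient (fun y => u y + ∑ j ∈ F, ψ j y) x = gradient (fun y => u y + ψ i y) x := by
  refine EventuallyEq.gradient_eq ?_
  have h : ∀ᶠ y in 𝓝 x, ∀ j ∈ F, j ≠ i → y ∉ B j := by
    refine (eventually_all_finset F).2 fun j _ => ?_
    by_cases hji : j = i
    · simp [hji]
    · filter_upwards [(hB j).isOpen_compl.mem_nhds fun hxj => (hd hji).ne_of_mem hxj hx rfl]
        with y hy _ using hy
  filter_upwards [h] with y hy
  rw [sum_eq_of_notMem_support hψ hi hy]

theorem gradient_add_sum_of_notMem (hB : ∀ i, IsClosed (B i)) (hψ : ∀ i, ∀ x ∉ B i, ψ i x = 0)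
    (u : Euc N → ℝ) {x : Euc N} (hx : ∀ i ∈ F, x ∉ B i) :
    gradient (fun y => u y + ∑ j ∈ F, ψ j y) x = gradient u x := by
  refine EventuallyEq.gradient_eq ?_
  have h : ∀ᶠ y in 𝓝 x, ∀ j ∈ F, y ∉ B j :=
    (eventually_all_finset F).2 fun j hj => (hB j).isOpen_compl.mem_nhds (hx j hj)
  filter_upwards [h] with y hy
  rw [Finset.sum_eq_zero fun i hi => hψ i y (hy i hi), add_zero]

theorem exists_lipschitzWith_sum (F : Finset ι) (hψ : ∀ i, ∃ C : ℝ≥0, LipschitzWith C (ψ i)) :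
    ∃ C : ℝ≥0, LipschitzWith C fun x => ∑ i ∈ F, ψ i x := by
  classical
  induction F using Finset.induction_on with
  | empty => exact ⟨0, by simp⟩
  | insert i F hi ih =>
    obtain ⟨C, hC⟩ := ih
    obtain ⟨D, hD⟩ := hψ i
    refine ⟨D + C, ?_⟩
    simp only [Finset.sum_insert hi]
    exact hD.add hC

theorem exists_lt_forall_finset_le {K C₀ : ℝ} (hC₀ : C₀ < K) (F : Finset ι) {c : ι → ℝ}
    (hc : ∀ i, c i < K) : ∃ C < K, C₀ ≤ C ∧ ∀ i ∈ F, c i ≤ C := by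
  classical
  induction F using Finset.induction_on with
  | empty => exact ⟨C₀, hC₀, le_rfl, by simp⟩
  | insert i F hi ih =>
    obtain ⟨C, hCK, h0, hC⟩ := ih
    refine ⟨max (c i) C, max_lt (hc i) hCK, h0.trans (le_max_right _ _), fun j hj => ?_⟩
    rcases Finset.mem_insert.1 hj with rfl | hj
    · exact le_max_left _ _
    · exact (hC j hj).trans (le_max_right _ _)

end Gluing

section Approximation

variable {N : ℕ}

theorem exists_pos_abs_setIntegral_le {Ω : Set (Euc N)} {a : Euc N → ℝ} (ha : IntegrableOn a Ω)
    {ε : ℝ} (hε : 0 < ε) :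
    ∃ η > 0, ∀ E, MeasurableSet E → E ⊆ Ω → volume E < ENNReal.ofReal η →
      ∀ g : Euc N → ℝ, (∀ᵐ x, x ∈ E → |g x| ≤ a x) → |∫ x in E, g x| ≤ ε := by
  obtain ⟨δ, hδ0, hδ⟩ := exists_pos_setLIntegral_lt_of_measure_lt ha.2.ne
    (ENNReal.ofReal_pos.2 hε).ne'
  have hmin : min δ 1 ≠ ∞ := (min_le_right _ _).trans_lt ENNReal.one_lt_top |>.ne
  refine ⟨(min δ 1).toReal, ENNReal.toReal_pos (lt_min hδ0 one_pos).ne' hmin, ?_⟩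
  intro E hE hEΩ hEη g hg
  rw [ENNReal.ofReal_toReal hmin] at hEη
  have h1 := hδ E ((Measure.restrict_apply_le Ω E).trans_lt (hEη.trans_le (min_le_left _ _)))
  rw [Measure.restrict_restrict hE, inter_eq_self_of_subset_left hEΩ] at h1
  have h2 : ‖∫ x in E, g x‖ₑ ≤ ∫⁻ x in E, ‖a x‖ₑ := by
    refine (enorm_integral_le_lintegral_enorm _).trans (lintegral_mono_ae ?_)
    rw [ae_restrict_iff' hE]
    filter_upwards [hg] with x hx hxE
    exact enorm_le_iff_norm_le.2 ((hx hxE).trans (le_abs_self _))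
  rw [← Real.norm_eq_abs, ← toReal_enorm]
  exact ENNReal.toReal_le_of_le_ofReal hε.le (h2.trans h1.le)

/-- From a countable family covering `T` up to a null set, finitely many members cover `T` up to a
set of small measure. -/
theorem exists_finset_volume_sdiff_lt {ι : Type*} [Countable ι] {T : Set (Euc N)}
    (hT : MeasurableSet T) (hTfin : volume T ≠ ∞) {B : ι → Set (Euc N)}
    (hB : ∀ i, MeasurableSet (B i)) (hcov : volume (T \ ⋃ i, B i) = 0) {δ : ℝ≥0∞} (hδ : 0 < δ) :
    ∃ F : Finset ι, volume (T \ ⋃ i ∈ F, B i) < δ := by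
  have hlim := tendsto_measure_iInter_atTop (μ := volume)
    (s := fun F : Finset ι => T \ ⋃ i ∈ F, B i)
    (fun F => (hT.diff (F.measurableSet_biUnion fun i _ => hB i)).nullMeasurableSet)
    (fun F F' h => sdiff_subset_sdiff_right (biUnion_subset_biUnion_left h))
    ⟨∅, ((measure_mono sdiff_subset).trans_lt hTfin.lt_top).ne⟩
  have h0 : volume (⋂ F : Finset ι, T \ ⋃ i ∈ F, B i) = 0 := by
    refine measure_mono_null (fun x hx => ?_) hcov
    rw [mem_iInter] at hx
    refine ⟨(hx ∅).1, fun hxB => ?_⟩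
    obtain ⟨i, hi⟩ := mem_iUnion.1 hxB
    exact (hx {i}).2 (by simpa using hi)
  rw [h0] at hlim
  exact (hlim.eventually (gt_mem_nhds hδ)).exists

/-- The approximation for a globally Lipschitz function, with a prescribed precision. -/
theorem exists_lipschitz_approximation {Ω : Set (Euc N)} (hΩ : IsOpen Ω)
    (hb : Bornology.IsBounded Ω) {K : ℝ} {f : Euc N → Euc N → ℝ} (hf : Hyp1 Ω K f)
    {u : Euc N → ℝ} {Cu : ℝ≥0} (hu : LipschitzWith Cu u) (hgrad : GradSupLt Ω u K)
    {ε : ℝ} (hε : 0 < ε) :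
    ∃ v : Euc N → ℝ, (∃ C : ℝ≥0, LipschitzWith C v) ∧ (∀ x ∉ Ω, v x = u x) ∧ GradSupLt Ω v K ∧
      (∀ x, |v x - u x| ≤ ε) ∧
      |(∫ x in Ω, f x (gradient v x)) -
        ∫ x in Ω, convexifyOn (f x) (ball (0 : Euc N) K) (gradient u x)| ≤ ε := by
  have hΩm : MeasurableSet Ω := hΩ.measurableSet
  have hΩfin : volume Ω ≠ ∞ := hb.measure_lt_top.ne
  obtain ⟨C₀, hC₀, hgrad⟩ := hgrad
  have hgradK : ∀ᵐ x ∂volume.restrict Ω, gradient u x ∈ ball (0 : Euc N) K :=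
    hgrad.mono fun x hx => mem_ball_zero_iff.2 (hx.trans_lt hC₀)
  have hFint := hf.integrableOn_convexifyOn hΩm (measurable_gradient u) hgradK
  rw [ae_restrict_iff' hΩm] at hgrad hgradK
  have hint : ∀ (G : Euc N → Euc N) (s : Set (Euc N)), Measurable G → MeasurableSet s → s ⊆ Ω →
      (∀ᵐ x, x ∈ s → G x ∈ ball (0 : Euc N) K) → IntegrableOn (fun x => f x (G x)) s :=
    fun G s hG hs hsΩ hGK => hf.integrableOn_comp hG hs hsΩ hGK
  obtain ⟨-, ⟨a, ha, hfa⟩, hc⟩ := hf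
  set H := Ω.indicator fun x => convexifyOn (f x) (ball (0 : Euc N) K) (gradient u x) with hHdef
  have hH : Integrable H := (integrable_indicator_iff hΩm).2 hFint
  have hHΩ : ∀ x ∈ Ω, H x = convexifyOn (f x) (ball (0 : Euc N) K) (gradient u x) :=
    fun x hx => indicator_of_mem hx _
  obtain ⟨η, hη0, hη⟩ := exists_pos_abs_setIntegral_le ha (half_pos hε)
  obtain ⟨T, hTΩ, hTc, hTη, hT⟩ := hc (η / 2) (half_pos hη0)
  have hTm : MeasurableSet T := hTc.measurableSet
  set V := volume.real Ω with hV
  have hV0 : 0 ≤ V := measureReal_nonneg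
  set e := min ε (ε / 2 / (V + 1)) with he
  have he0 : 0 < e := by positivity
  have heV : e * V ≤ ε / 2 := by
    have h1 : e * (V + 1) ≤ ε / 2 := by
      rw [← le_div_iff₀ (by positivity)]
      exact min_le_right _ _
    nlinarith
  set P : Euc N → ℝ → Prop := fun x₀ r => closedBall x₀ r ⊆ Ω ∧ ∃ ψ : Euc N → ℝ,
      (∃ C : ℝ≥0, LipschitzWith C ψ) ∧ (∀ x, x ∉ closedBall x₀ r → ψ x = 0) ∧
      (∀ x, |ψ x| ≤ e) ∧
      (∃ C < K, ∀ᵐ x, x ∈ closedBall x₀ r → ‖gradient (fun y => u y + ψ y) x‖ ≤ C) ∧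
      |∫ x in closedBall x₀ r ∩ T, (f x (gradient (fun y => u y + ψ y) x) - H x)| ≤
        e * volume.real (closedBall x₀ r) with hP
  have hgu : LocallyIntegrable (gradient u) :=
    (locallyIntegrable_const (Cu : ℝ)).mono (measurable_gradient u).aestronglyMeasurable
      (Eventually.of_forall fun x => by
        simpa using hu.norm_gradient_le x)
  have hgood : ∀ᵐ x, x ∈ T → ∀ᶠ r in 𝓝[>] (0 : ℝ), P x r := by
    filter_upwards [hu.ae_differentiableAt, hgrad, ae_eventually_setIntegral_norm_sub_le hgu,
      ae_eventually_setIntegral_norm_sub_le hH.locallyIntegrable,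
      ae_mem_eventually_volume_diff_le hTm] with x hd hg hLu hLH hdens hx
    exact eventually_exists_good_perturbation hu hΩ hTΩ hTm hC₀ hgrad hfa hint hH hx (hT x hx) hd
      (hg (hTΩ hx)) (hHΩ x (hTΩ hx)) hLu hLH (hdens hx) he0
  obtain ⟨t, r, htc, hts, htr, htcov, htd⟩ := Besicovitch.exists_disjoint_closedBall_covering_ae
    (volume : Measure (Euc N)) (fun x => {r | P x r}) {x | x ∈ T ∧ ∀ᶠ r in 𝓝[>] (0 : ℝ), P x r}
    (fun x hx δ hδ => (hx.2.and (Ioo_mem_nhdsGT hδ)).exists) (fun _ => 1) fun _ _ => one_pos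
  have : Countable t := htc.to_subtype
  set B : t → Set (Euc N) := fun i => closedBall (i : Euc N) (r i) with hBdef
  have hBm : ∀ i, MeasurableSet (B i) := fun i => measurableSet_closedBall
  have hBc : ∀ i, IsClosed (B i) := fun i => isClosed_closedBall
  have hBd : Pairwise (Function.onFun Disjoint B) := fun i j hij =>
    htd i.2 j.2 (Subtype.coe_injective.ne hij)
  have hBfin : ∀ i, volume (B i) ≠ ∞ := fun i => measure_closedBall_lt_top.ne
  have hcov : volume (T \ ⋃ i, B i) = 0 := by
    have : T \ ⋃ i, B i ⊆ {x | x ∈ T ∧ ∀ᶠ r in 𝓝[>] (0 : ℝ), P x r} \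
        (⋃ x ∈ t, closedBall x (r x)) ∪ {x | ¬ (x ∈ T → ∀ᶠ r in 𝓝[>] (0 : ℝ), P x r)} := by
      intro x hx
      by_cases hxP : ∀ᶠ r in 𝓝[>] (0 : ℝ), P x r
      · refine Or.inl ⟨⟨hx.1, hxP⟩, ?_⟩
        rw [biUnion_eq_iUnion]
        exact hx.2
      · exact Or.inr fun h => hxP (h hx.1)
    exact measure_mono_null this (measure_union_null htcov hgood)
  obtain ⟨F, hF⟩ := exists_finset_volume_sdiff_lt hTm
    ((measure_mono hTΩ).trans_lt hΩfin.lt_top).ne hBm hcov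
    (ENNReal.ofReal_pos.2 (half_pos hη0))
  choose hBΩ ψ hψL hψ0 hψe hψC hψI using fun i : t => (htr i i.2).1
  choose c hcK hψc using hψC
  obtain ⟨C, hCK, hC₀C, hcC⟩ := exists_lt_forall_finset_le hC₀ F hcK
  obtain ⟨Cs, hCs⟩ := exists_lipschitzWith_sum F hψL
  set v : Euc N → ℝ := fun x => u x + ∑ i ∈ F, ψ i x with hv
  have hvC : ∀ᵐ x, x ∈ Ω → ‖gradient v x‖ ≤ C := by
    filter_upwards [hgrad, ae_all_iff.2 hψc] with x hgx hψx hx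
    by_cases h : ∃ i ∈ F, x ∈ B i
    · obtain ⟨i, hi, hxi⟩ := h
      rw [hv, gradient_add_sum_of_mem hBc hψ0 hBd u hi hxi]
      exact (hψx i hxi).trans (hcC i hi)
    · push Not at h
      rw [hv, gradient_add_sum_of_notMem hBc hψ0 u h]
      exact (hgx hx).trans hC₀C
  have hvK : ∀ᵐ x, x ∈ Ω → gradient v x ∈ ball (0 : Euc N) K :=
    hvC.mono fun x hx hxΩ => mem_ball_zero_iff.2 ((hx hxΩ).trans_lt hCK)
  refine ⟨v, ⟨Cu + Cs, hu.add hCs⟩, fun x hx => ?_, ⟨C, hCK, (ae_restrict_iff' hΩm).2 hvC⟩,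
    fun x => ?_, ?_⟩
  · simp only [hv]
    rw [Finset.sum_eq_zero fun i _ => hψ0 i x fun hxi => hx (hBΩ i hxi), add_zero]
  · simp only [hv, add_sub_cancel_left]
    exact (abs_sum_le_of_disjoint_support hψ0 hBd he0.le hψe x).trans (min_le_left _ _)
  have hfv := hint _ _ (measurable_gradient v) hΩm Subset.rfl hvK
  have hHF : ∫ x in Ω, convexifyOn (f x) (ball (0 : Euc N) K) (gradient u x) = ∫ x in Ω, H x :=
    setIntegral_congr_fun hΩm fun x hx => (hHΩ x hx).symm
  have hDint : IntegrableOn (fun x => f x (gradient v x) - H x) Ω := hfv.sub hH.integrableOn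
  rw [hHF, ← integral_sub hfv hH.integrableOn]
  set W := ⋃ i ∈ F, B i ∩ T with hW
  have hWm : MeasurableSet W := F.measurableSet_biUnion fun i _ => (hBm i).inter hTm
  have hWΩ : W ⊆ Ω := iUnion₂_subset fun i _ => inter_subset_right.trans hTΩ
  have hI₁ : |∫ x in W, (f x (gradient v x) - H x)| ≤ ε / 2 := by
    rw [hW, integral_biUnion_finset F (fun i _ => (hBm i).inter hTm)
      (fun i _ j _ hij => (hBd hij).mono inter_subset_left inter_subset_left)
      fun i _ => hDint.mono_set (inter_subset_right.trans hTΩ)]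
    calc |∑ i ∈ F, ∫ x in B i ∩ T, (f x (gradient v x) - H x)|
        ≤ ∑ i ∈ F, |∫ x in B i ∩ T, (f x (gradient v x) - H x)| := Finset.abs_sum_le_sum_abs _ _
      _ ≤ ∑ i ∈ F, e * volume.real (B i) := by
          refine Finset.sum_le_sum fun i hi => ?_
          refine le_of_eq_of_le (congrArg abs ?_) (hψI i)
          refine setIntegral_congr_fun ((hBm i).inter hTm) fun x hx => ?_
          simp only [hv]
          rw [gradient_add_sum_of_mem hBc hψ0 hBd u hi hx.1]
      _ = e * volume.real (⋃ i ∈ F, B i) := by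
          rw [← Finset.mul_sum, measureReal_biUnion_finset (fun i _ j _ hij => hBd hij)
            (fun i _ => hBm i) fun i _ => hBfin i]
      _ ≤ e * V := mul_le_mul_of_nonneg_left
          (measureReal_mono (iUnion₂_subset fun i _ => hBΩ i) hΩfin) he0.le
      _ ≤ ε / 2 := heV
  have hI₂ : |∫ x in Ω \ W, (f x (gradient v x) - H x)| ≤ ε / 2 := by
    refine hη _ (hΩm.diff hWm) sdiff_subset ?_ _ ?_
    · have hsub : Ω \ W ⊆ (Ω \ T) ∪ (T \ ⋃ i ∈ F, B i) := by
        rintro x ⟨hxΩ, hxW⟩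
        by_cases hxT : x ∈ T
        · refine Or.inr ⟨hxT, fun hxB => hxW ?_⟩
          simp only [mem_iUnion, hW] at hxB ⊢
          obtain ⟨i, hi, hxi⟩ := hxB
          exact ⟨i, hi, hxi, hxT⟩
        · exact Or.inl ⟨hxΩ, hxT⟩
      calc volume (Ω \ W) ≤ volume (Ω \ T) + volume (T \ ⋃ i ∈ F, B i) :=
            (measure_mono hsub).trans (measure_union_le _ _)
        _ < ENNReal.ofReal (η / 2) + ENNReal.ofReal (η / 2) := ENNReal.add_lt_add hTη hF
        _ = ENNReal.ofReal η := by
            rw [← ENNReal.ofReal_add (half_pos hη0).le (half_pos hη0).le, add_halves]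
    · filter_upwards [hvK, hgradK] with x hvx hux hx
      have h0 : ∀ ζ ∈ ball (0 : Euc N) K, 0 ≤ f x ζ := fun ζ hζ => (hfa x hx.1 ζ hζ).1
      have h1 := hfa x hx.1 _ (hvx hx.1)
      have h2 := convexifyOn_nonneg (hux hx.1) h0
      have h3 := (convexifyOn_le (hux hx.1) h0).trans (hfa x hx.1 _ (hux hx.1)).2
      rw [hHΩ x hx.1, abs_le]
      constructor <;> linarith [h1.1, h1.2]
  have hsplit := integral_inter_add_sdiff hWm hDint
  rw [inter_eq_self_of_subset_right hWΩ] at hsplit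
  rw [← hsplit]
  exact (abs_add_le _ _).trans (by linarith)

end Approximation

/-- Theorem 2.3, first part: under Hypothesis 1, for every
`u ∈ W^{1,∞}(Ω)` with `‖∇u‖_∞ < K` there is a sequence `v_n ∈ u + W_0^{1,∞}(Ω)` with
`‖∇v_n‖_∞ < K`, `‖v_n - u‖_∞ → 0` and `∫_Ω f̃(x,∇v_n) dx → ∫_Ω f̃**(x,∇u) dx`. -/
theorem approximation_x_grad
    {N : ℕ} (Ω : Set (Euc N)) (hΩ : IsLipschitzDomain Ω) (K : ℕ)
    (f : Euc N → Euc N → ℝ) (hf : Hyp1 Ω (K : ℝ) f)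
    (u : Euc N → ℝ) (hu : MemW1inf Ω u) (hgrad : GradSupLt Ω u (K : ℝ)) :
    ∃ v : ℕ → Euc N → ℝ,
      (∀ n, MemW1inf Ω (v n) ∧ Set.EqOn (v n) u (frontier Ω) ∧ GradSupLt Ω (v n) (K : ℝ)) ∧
      TendstoUniformlyOn v u atTop Ω ∧
      Tendsto (fun n => ∫ x in Ω, f x (gradient (v n) x)) atTop
        (𝓝 (∫ x in Ω, convexifyOn (f x) (ball (0 : Euc N) (K : ℝ)) (gradient u x))) := by
  obtain ⟨hΩo, hΩb, -⟩ := hΩ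
  obtain ⟨Cu, hu⟩ := hu
  obtain ⟨w, hw, huw⟩ := hu.extend_real
  have hgw : ∀ x ∈ Ω, gradient w x = gradient u x := fun x hx =>
    EventuallyEq.gradient_eq
      ((hΩo.eventually_mem hx).mono fun y hy => (huw (subset_closure hy)).symm)
  have hgradw : GradSupLt Ω w K := by
    obtain ⟨C, hCK, hC⟩ := hgrad
    refine ⟨C, hCK, ?_⟩
    filter_upwards [hC, ae_restrict_mem hΩo.measurableSet] with x hx hxΩ
    rwa [hgw x hxΩ]
  have hlim : Tendsto (fun n : ℕ => 1 / ((n : ℝ) + 1)) atTop (𝓝 0) :=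
    tendsto_one_div_add_atTop_nhds_zero_nat
  choose v hvL hvw hvK hvε hvI using fun n : ℕ =>
    exists_lipschitz_approximation hΩo hΩb hf hw hgradw (Nat.one_div_pos_of_nat (n := n) (α := ℝ))
  refine ⟨v, fun n => ⟨(hvL n).imp fun C hC => hC.lipschitzOnWith, fun x hx => ?_, hvK n⟩, ?_, ?_⟩
  · rw [hΩo.frontier_eq] at hx
    rw [hvw n x hx.2, huw hx.1]
  · rw [Metric.tendstoUniformlyOn_iff]
    intro ε hε
    filter_upwards [hlim.eventually (gt_mem_nhds hε)] with n hn x hx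
    rw [dist_comm, Real.dist_eq, huw (subset_closure hx)]
    exact (hvε n x).trans_lt hn
  · have hI : ∫ x in Ω, convexifyOn (f x) (ball (0 : Euc N) K) (gradient u x) =
        ∫ x in Ω, convexifyOn (f x) (ball (0 : Euc N) K) (gradient w x) :=
      setIntegral_congr_fun hΩo.measurableSet fun x hx => by simp only [hgw x hx]
    rw [hI, tendsto_iff_dist_tendsto_zero]
    exact squeeze_zero (fun _ => dist_nonneg) hvI hlim
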